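/- arXiv:1205.1851 — 2 statements merged into one kernel-verified Lean document; each statement's English description precedes it below -/
import Mathlib

section
/- Suppose the positive function ε satisfies: for all partitions α, γ of Fin n with α < α ⊔ γ and γ < α ⊔ γ, one has 2n(ε(α) + ε(γ)) < ε(α ⊔ γ). Then for every partition β of Fin n, the sets {V_{α,β}}_{α < β} form an open covering of X^n ∖ U_β: each V_{α,β} is open in the subspace topology of X^n ∖ U_β, and for every x ∈ X^n with x ∉ U_β there exists a partition α < β with x ∈ V_{α,β}. -/
/-- The diagonal `Δ_α ⊆ Xⁿ` associated to a partition (equivalence relation) `α` of `Fin n`. -/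
def diagSet {X : Type*} {n : ℕ} (α : Setoid (Fin n)) : Set (Fin n → X) :=
  {y | ∀ i j, α i j → y i = y j}

/-- The open `ε(α)`-neighbourhood `U_α` of the diagonal `Δ_α` in `Xⁿ` (sup metric). -/
def Uset {X : Type*} [MetricSpace X] {n : ℕ} (ε : Setoid (Fin n) → ℝ)
    (α : Setoid (Fin n)) : Set (Fin n → X) :=
  {x | Metric.infDist x (diagSet α) < ε α}

/-- The set `V_{α,β} = (Xⁿ ∖ U_β) ∖ ⋃_{γ < β, γ ≰ α} closure (U_γ)`. -/
def Vset {X : Type*} [MetricSpace X] {n : ℕ} (ε : Setoid (Fin n) → ℝ)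
    (α β : Setoid (Fin n)) : Set (Fin n → X) :=
  (Uset ε β)ᶜ \ ⋃ γ ∈ {γ : Setoid (Fin n) | γ < β ∧ ¬γ ≤ α}, closure (Uset ε γ)

/-- Along a walk whose steps move a function by at most `c`, the function moves by at most
`c` times the length of the walk. -/
theorem dist_le_walk_length_mul {V X : Type*} [PseudoMetricSpace X]
    {G : SimpleGraph V} {x : V → X} {c : ℝ} (h : ∀ i j, G.Adj i j → dist (x i) (x j) ≤ c)
    {i j : V} (p : G.Walk i j) : dist (x i) (x j) ≤ p.length * c := by
  induction p with
  | nil => simp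
  | @cons u v w huv p ih =>
    have := dist_triangle (x u) (x v) (x w)
    have := h u v huv
    push_cast [SimpleGraph.Walk.length_cons]
    linarith

/-- If related indices for `α` and for `γ` have values at distance at most `c`, then related
indices for `α ⊔ γ` have values at distance at most `n * c`. -/
theorem dist_le_of_sup_rel {X : Type*} [PseudoMetricSpace X] {n : ℕ} {x : Fin n → X} {c : ℝ}
    (hc : 0 ≤ c) {α γ : Setoid (Fin n)} (hα : ∀ i j, α i j → dist (x i) (x j) ≤ c)
    (hγ : ∀ i j, γ i j → dist (x i) (x j) ≤ c) {i j : Fin n} (hij : (α ⊔ γ) i j) :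
    dist (x i) (x j) ≤ n * c := by
  let G : SimpleGraph (Fin n) := SimpleGraph.fromRel fun i j => α i j ∨ γ i j
  have hG : ∀ i j, G.Adj i j → dist (x i) (x j) ≤ c := by
    rintro i j ⟨-, (h | h) | (h | h)⟩
    · exact hα i j h
    · exact hγ i j h
    · exact hα i j (α.symm' h)
    · exact hγ i j (γ.symm' h)
  have hreach : G.Reachable i j := by
    have hle : α ⊔ γ ≤ G.reachableSetoid := by
      refine sup_le ?_ ?_ <;> intro a b hab <;> by_cases h : a = b
      · exact h ▸ SimpleGraph.Reachable.refl a
      · exact SimpleGraph.Adj.reachable ⟨h, Or.inl (Or.inl hab)⟩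
      · exact h ▸ SimpleGraph.Reachable.refl a
      · exact SimpleGraph.Adj.reachable ⟨h, Or.inl (Or.inr hab)⟩
    exact hle hij
  obtain ⟨p, hp⟩ := hreach.exists_isPath
  have hlen : (p.length : ℝ) ≤ n := by
    have := hp.length_lt
    rw [Fintype.card_fin] at this
    exact_mod_cast this.le
  exact (dist_le_walk_length_mul hG p).trans (mul_le_mul_of_nonneg_right hlen hc)

theorem diagSet_nonempty {X : Type*} [Nonempty X] {n : ℕ} (α : Setoid (Fin n)) :
    (diagSet α : Set (Fin n → X)).Nonempty :=
  ⟨fun _ => Classical.arbitrary X, fun _ _ _ => rfl⟩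

theorem infDist_le_of_mem_closure_Uset {X : Type*} [MetricSpace X] {n : ℕ}
    {ε : Setoid (Fin n) → ℝ} {α : Setoid (Fin n)} {x : Fin n → X}
    (hx : x ∈ closure (Uset ε α)) : Metric.infDist x (diagSet α) ≤ ε α :=
  closure_minimal (fun _ hy => le_of_lt hy)
    (isClosed_le (Metric.continuous_infDist_pt _) continuous_const) hx

/-- Coordinates related by `α` differ by at most twice the distance to the diagonal. -/
theorem dist_le_two_mul_infDist_diagSet {X : Type*} [MetricSpace X] {n : ℕ}
    {α : Setoid (Fin n)} {x : Fin n → X} {i j : Fin n} (hij : α i j) :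
    dist (x i) (x j) ≤ 2 * Metric.infDist x (diagSet α) := by
  have : Nonempty X := ⟨x i⟩
  have h : dist (x i) (x j) / 2 ≤ Metric.infDist x (diagSet α) := by
    refine (Metric.le_infDist (diagSet_nonempty α)).2 fun y hy => ?_
    have h₁ := dist_triangle_right (x i) (x j) (y i)
    have h₂ := dist_le_pi_dist x y i
    have h₃ := dist_le_pi_dist x y j
    rw [← hy i j hij] at h₃
    linarith
  linarith

/-- If coordinates related by `α` differ by at most `c`, the distance to the diagonal is at
most `c`. -/
theorem infDist_diagSet_le {X : Type*} [MetricSpace X] {n : ℕ} {α : Setoid (Fin n)}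
    {x : Fin n → X} {c : ℝ} (hc : 0 ≤ c) (h : ∀ i j, α i j → dist (x i) (x j) ≤ c) :
    Metric.infDist x (diagSet α) ≤ c := by
  let y : Fin n → X := fun i => x (Quotient.mk α i).out
  have hy : y ∈ (diagSet α : Set (Fin n → X)) := fun i j hij =>
    congrArg (fun q : Quotient α => x q.out) (Quotient.sound hij)
  refine (Metric.infDist_le_dist_of_mem hy).trans ((dist_pi_le_iff hc).2 fun i => h _ _ ?_)
  exact α.symm' (Quotient.mk_out i)

theorem mem_Uset_sup {X : Type*} [MetricSpace X] {n : ℕ} {ε : Setoid (Fin n) → ℝ}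
    (hε : ∀ α, 0 < ε α) {α γ : Setoid (Fin n)} (h : 2 * n * (ε α + ε γ) < ε (α ⊔ γ))
    {x : Fin n → X} (hα : x ∈ closure (Uset ε α)) (hγ : x ∈ closure (Uset ε γ)) :
    x ∈ Uset ε (α ⊔ γ) := by
  have hα' := infDist_le_of_mem_closure_Uset hα
  have hγ' := infDist_le_of_mem_closure_Uset hγ
  have hεα := hε α
  have hεγ := hε γ
  have hc : 0 ≤ 2 * (ε α + ε γ) := by positivity
  have key : Metric.infDist x (diagSet (α ⊔ γ)) ≤ n * (2 * (ε α + ε γ)) := by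
    refine infDist_diagSet_le (by positivity) fun i j hij =>
      dist_le_of_sup_rel hc (fun i j hij => ?_) (fun i j hij => ?_) hij
    · linarith [dist_le_two_mul_infDist_diagSet (x := x) hij]
    · linarith [dist_le_two_mul_infDist_diagSet (x := x) hij]
  exact key.trans_lt (by linarith)

theorem mem_Uset_bot {X : Type*} [MetricSpace X] {n : ℕ} {ε : Setoid (Fin n) → ℝ}
    (hε : ∀ α, 0 < ε α) (x : Fin n → X) : x ∈ Uset ε ⊥ := by
  have hx : x ∈ (diagSet ⊥ : Set (Fin n → X)) := fun i j hij => congrArg x hij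
  simpa [Uset, Metric.infDist_zero_of_mem hx] using hε ⊥

/-- If the positive function `ε` grows fast enough along joins, i.e.
`2n(ε(α) + ε(γ)) < ε(α ⊔ γ)` whenever `α, γ < α ⊔ γ`, then for every partition `β` the sets
`V_{α,β}` for `α < β` form an open covering of `Xⁿ ∖ U_β`: each is open in the subspace
topology of `Xⁿ ∖ U_β`, and every point of `Xⁿ ∖ U_β` lies in some `V_{α,β}` with `α < β`. -/
theorem Vsets_open_cover {X : Type*} [MetricSpace X] {n : ℕ} (hn : 0 < n)
    (ε : Setoid (Fin n) → ℝ) (hε : ∀ α, 0 < ε α)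
    (hgrow : ∀ α γ : Setoid (Fin n), α < α ⊔ γ → γ < α ⊔ γ →
      2 * n * (ε α + ε γ) < ε (α ⊔ γ))
    (β : Setoid (Fin n)) :
    (∀ α : Setoid (Fin n), α < β →
      IsOpen (Subtype.val ⁻¹' Vset ε α β : Set (((Uset ε β)ᶜ : Set (Fin n → X))))) ∧
    (∀ x : Fin n → X, x ∉ Uset ε β → ∃ α : Setoid (Fin n), α < β ∧ x ∈ Vset ε α β) := by
  have hfin : Finite (Setoid (Fin n)) :=
    Finite.of_injective (fun α : Setoid (Fin n) => (α : Fin n → Fin n → Prop))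
      fun _ _ h => Setoid.ext fun i j => iff_of_eq (congrFun (congrFun h i) j)
  refine ⟨fun α _ => ?_, fun x hx => ?_⟩
  · have hclosed : IsClosed
        (⋃ γ ∈ {γ : Setoid (Fin n) | γ < β ∧ ¬γ ≤ α}, closure (Uset (X := X) ε γ)) :=
      (Set.toFinite _).isClosed_biUnion fun _ _ => isClosed_closure
    have heq : (Subtype.val ⁻¹' Vset ε α β : Set ((Uset ε β)ᶜ : Set (Fin n → X))) =
        Subtype.val ⁻¹'
          (⋃ γ ∈ {γ : Setoid (Fin n) | γ < β ∧ ¬γ ≤ α}, closure (Uset (X := X) ε γ))ᶜ :=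
      Set.ext fun y => ⟨fun h => h.2, fun h => ⟨y.2, h⟩⟩
    rw [heq]
    exact hclosed.isOpen_compl.preimage continuous_subtype_val
  · let S : Set (Setoid (Fin n)) := {γ | γ < β ∧ x ∈ closure (Uset ε γ)}
    have hbot : ⊥ ∈ S :=
      ⟨bot_lt_iff_ne_bot.2 fun h => hx (h ▸ mem_Uset_bot hε x),
        subset_closure (mem_Uset_bot hε x)⟩
    have hsup : ∀ α ∈ S, ∀ γ ∈ S, α ⊔ γ ∈ S := by
      intro α hα γ hγ
      rcases le_sup_left.eq_or_lt (a := α) (b := α ⊔ γ) with h₁ | h₁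
      · exact h₁ ▸ hα
      rcases le_sup_right.eq_or_lt (a := γ) (b := α ⊔ γ) with h₂ | h₂
      · exact h₂ ▸ hγ
      have hmem := mem_Uset_sup hε (hgrow α γ h₁ h₂) hα.2 hγ.2
      exact ⟨(sup_le hα.1.le hγ.1.le).lt_of_ne fun h => hx (h ▸ hmem), subset_closure hmem⟩
    obtain ⟨α, hα⟩ := (Set.toFinite S).exists_maximal ⟨⊥, hbot⟩
    refine ⟨α, hα.prop.1, hx, ?_⟩
    simp only [Set.mem_iUnion, not_exists]
    rintro γ ⟨hγβ, hγα⟩ hγ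
    exact hγα (le_sup_right.trans
      (hα.le_of_ge (hsup α hα.prop γ ⟨hγβ, hγ⟩) le_sup_left))
end

section
/- In the lattice of partitions (equivalence relations) of Fin n, ordered by refinement, the Möbius function μ of the associated incidence algebra over ℚ satisfies, for every partition γ, μ(γ, ⊤) = (−1)^{c(γ)−1} · (c(γ)−1)!, where c(γ) is the number of equivalence classes of γ and ⊤ is the partition with a single block. In particular μ(⊥, ⊤) = (−1)^{n−1}(n−1)! for the discrete partition ⊥. -/
open scoped Classical

/-- The type of partitions (equivalence relations) of `Fin n` is finite. -/
noncomputable instance setoidFinFintype (n : ℕ) : Fintype (Setoid (Fin n)) :=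
  Fintype.ofInjective (fun s : Setoid (Fin n) => s.r)
    (fun a b h => Setoid.ext fun x y => by rw [show a.r = b.r from h])

/-- The lattice of partitions of `Fin n` is a locally finite order (being finite). -/
noncomputable instance setoidFinLocallyFinite (n : ℕ) :
    LocallyFiniteOrder (Setoid (Fin n)) :=
  Fintype.toLocallyFiniteOrder

open Polynomial in
/-- The linear coefficient of the falling factorial `X (X - 1) ⋯ (X - k)` is `(-1) ^ k * k!`. -/
theorem coeff_one_descPochhammer_succ (R : Type*) [CommRing R] (k : ℕ) :
    (descPochhammer R (k + 1)).coeff 1 = (-1) ^ k * (k.factorial : R) := by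
  have heval : (descPochhammer R k).eval (-1) = (-1) ^ k * (k.factorial : R) := by
    induction k with
    | zero => simp
    | succ k ih =>
      rw [descPochhammer_succ_eval, ih, Nat.factorial_succ]
      push_cast
      ring
  rw [descPochhammer_succ_left, coeff_X_mul, coeff_zero_eq_eval_zero, eval_comp]
  simpa using heval

/-- Functions with kernel exactly `δ` are injections on the quotient by `δ`. -/
noncomputable def kerEqEquivEmbedding {α β : Type*} (δ : Setoid α) :
    {f : α → β // Setoid.ker f = δ} ≃ (Quotient δ ↪ β) where
  toFun f := ⟨Quotient.lift f.1 (fun _ _ h => (f.2.ge : δ ≤ Setoid.ker f.1) h),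
    (Setoid.lift_injective_iff_ker_eq_of_le f.2.ge).2 f.2⟩
  invFun g := ⟨fun a => g (Quotient.mk δ a), Setoid.ext fun _ _ =>
    g.injective.eq_iff.trans Quotient.eq⟩
  left_inv _ := rfl
  right_inv g := by
    ext q
    induction q using Quotient.inductionOn
    rfl

/-- Counting the functions that are constant on the blocks of `γ` by their kernels. -/
theorem sum_descFactorial_card_quotient {α : Type*} [Fintype α] [Fintype (Setoid α)]
    (γ : Setoid α) (m : ℕ) :
    ∑ δ : Setoid α with γ ≤ δ, m.descFactorial (Fintype.card (Quotient δ)) =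
      m ^ Fintype.card (Quotient γ) := by
  have hcount : Fintype.card {f : α → Fin m // γ ≤ Setoid.ker f} =
      m ^ Fintype.card (Quotient γ) := by
    rw [Fintype.card_congr (Setoid.liftEquiv γ), Fintype.card_fun, Fintype.card_fin]
  rw [← hcount, Fintype.card_subtype,
    Finset.card_eq_sum_card_fiberwise (f := Setoid.ker) (t := {δ : Setoid α | γ ≤ δ})
      (fun f hf => by simpa using hf)]
  refine Finset.sum_congr rfl fun δ hδ => ?_
  have hfiber : Finset.filter (fun f : α → Fin m => Setoid.ker f = δ) {f | γ ≤ Setoid.ker f} =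
      Finset.filter (fun f => Setoid.ker f = δ) Finset.univ := by
    ext f
    simp only [Finset.mem_filter, Finset.mem_univ, true_and] at hδ ⊢
    exact ⟨And.right, fun h => ⟨h ▸ hδ, h⟩⟩
  rw [hfiber, ← Fintype.card_subtype, Fintype.card_congr (kerEqEquivEmbedding δ),
    Fintype.card_embedding_eq, Fintype.card_fin]

open Polynomial in
/-- The expansion of a monomial into falling factorials, indexed by the partitions above `γ`. -/
theorem sum_descPochhammer_card_quotient {α : Type*} [Fintype α] [Fintype (Setoid α)]
    (γ : Setoid α) :
    ∑ δ : Setoid α with γ ≤ δ, descPochhammer ℚ (Fintype.card (Quotient δ)) =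
      X ^ Fintype.card (Quotient γ) := by
  refine Polynomial.eq_of_infinite_eval_eq _ _
    ((Set.infinite_range_of_injective (Nat.cast_injective (R := ℚ))).mono ?_)
  rintro _ ⟨m, rfl⟩
  simp only [Set.mem_ofPred_eq, eval_finsetSum, descPochhammer_eval_eq_descFactorial, eval_pow,
    eval_X]
  exact_mod_cast sum_descFactorial_card_quotient γ m

theorem Setoid.card_quotient_eq_one_iff {α : Type*} [Fintype α] [Nonempty α] (γ : Setoid α) :
    Fintype.card (Quotient γ) = 1 ↔ γ = ⊤ := by
  have : Nonempty (Quotient γ) := Nonempty.map (Quotient.mk γ) ‹_›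
  rw [← Quotient.subsingleton_iff, ← Fintype.card_le_one_iff_subsingleton]
  have := Fintype.card_pos (α := Quotient γ)
  omega

theorem sum_sign_mul_factorial_card_quotient {α : Type*} [Fintype α] [Nonempty α]
    [Fintype (Setoid α)] (γ : Setoid α) :
    ∑ δ : Setoid α with γ ≤ δ, (-1 : ℚ) ^ (Fintype.card (Quotient δ) - 1) *
      ((Fintype.card (Quotient δ) - 1).factorial : ℚ) = if γ = ⊤ then 1 else 0 := by
  have h := congrArg (fun p => p.coeff 1) (sum_descPochhammer_card_quotient γ)
  simp only [Polynomial.finsetSum_coeff, Polynomial.coeff_X_pow] at h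
  simp only [eq_comm (a := 1), Setoid.card_quotient_eq_one_iff] at h
  rw [← h]
  refine Finset.sum_congr rfl fun δ _ => ?_
  have : Nonempty (Quotient δ) := Nonempty.map (Quotient.mk δ) ‹_›
  rw [← coeff_one_descPochhammer_succ, Nat.sub_add_cancel Fintype.card_pos]

/-- The Möbius function into the top element is determined by its sums over upper intervals. -/
theorem IncidenceAlgebra.mu_top_eq_of_sum_eq {𝕜 α : Type*} [CommRing 𝕜] [PartialOrder α]
    [OrderTop α] [Fintype α] [LocallyFiniteOrder α] (f : α → 𝕜)
    (hf : ∀ a, ∑ b : α with a ≤ b, f b = if a = ⊤ then 1 else 0) (a : α) :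
    IncidenceAlgebra.mu 𝕜 a ⊤ = f a := by
  induction a using WellFoundedGT.induction with
  | ind a ih =>
    have hIcc : Finset.univ.filter (a ≤ ·) = Finset.Icc a ⊤ := by ext; simp
    have h := (IncidenceAlgebra.sum_Icc_mu_left a ⊤).trans (hf a).symm
    rw [hIcc, ← Finset.Ioc_insert_left le_top, Finset.sum_insert (by simp),
      Finset.sum_insert (by simp),
      Finset.sum_congr rfl fun b hb => ih b (Finset.mem_Ioc.1 hb).1] at h
    exact add_right_cancel h

/-- In the lattice of partitions of `Fin n`, the Möbius function of the incidence algebra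
over `ℚ` satisfies `μ(γ, ⊤) = (-1)^(c(γ)-1) (c(γ)-1)!`, where `c(γ)` is the number of
equivalence classes of `γ` and `⊤` is the one-block partition. In particular
`μ(⊥, ⊤) = (-1)^(n-1) (n-1)!` for the discrete partition `⊥`. -/
theorem mu_partition_lattice_top {n : ℕ} (hn : 0 < n) :
    (∀ γ : Setoid (Fin n),
      IncidenceAlgebra.mu ℚ γ (⊤ : Setoid (Fin n)) =
        (-1 : ℚ) ^ (Fintype.card (Quotient γ) - 1) *
          (Nat.factorial (Fintype.card (Quotient γ) - 1) : ℚ)) ∧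
    IncidenceAlgebra.mu ℚ (⊥ : Setoid (Fin n)) (⊤ : Setoid (Fin n)) =
      (-1 : ℚ) ^ (n - 1) * (Nat.factorial (n - 1) : ℚ) := by
  have : Nonempty (Fin n) := ⟨⟨0, hn⟩⟩
  have hmu := IncidenceAlgebra.mu_top_eq_of_sum_eq _
    (sum_sign_mul_factorial_card_quotient (α := Fin n))
  refine ⟨hmu, ?_⟩
  rw [hmu, Fintype.card_congr Setoid.quotientBotEquiv, Fintype.card_fin]
end
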